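/- Let G be a unicyclic simple graph on n ≥ 3 vertices. Then the path energy satisfies PE(G) ≤ 4(n − 1), with equality if and only if G is the cycle C_n. -/

import Mathlib

open SimpleGraph Polynomial

/-- Two walks from `u` to `v` are *internally disjoint* if their supports
meet only in the endpoints `u` and `v`. -/
def InternallyDisjoint {V : Type*} {G : SimpleGraph V} {u v : V}
    (p q : G.Walk u v) : Prop :=
  ∀ w, w ∈ p.support → w ∈ q.support → w = u ∨ w = v

/-- The maximum number of pairwise internally vertex-disjoint paths from `u` to `v`. -/
noncomputable def maxDisjointPaths {V : Type*} (G : SimpleGraph V) (u v : V) : ℕ :=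
  sSup {m : ℕ | ∃ f : Fin m → G.Path u v, Function.Injective f ∧
    ∀ i j, i ≠ j → InternallyDisjoint (f i).1 (f j).1}

/-- The path matrix of a graph on `Fin n`. -/
noncomputable def pathMatrix {n : ℕ} (G : SimpleGraph (Fin n)) :
    Matrix (Fin n) (Fin n) ℝ :=
  Matrix.of fun i j => if i = j then 0 else (maxDisjointPaths G i j : ℝ)

/-- The path energy: sum of the absolute values of the eigenvalues of the path matrix
(the roots, with multiplicity, of its characteristic polynomial). -/
noncomputable def pathEnergy {n : ℕ} (G : SimpleGraph (Fin n)) : ℝ :=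
  ((pathMatrix G).charpoly.roots.map (fun x => |x|)).sum

/-- The path spectral radius: the largest eigenvalue of the path matrix. -/
noncomputable def pathSpectralRadius {n : ℕ} (G : SimpleGraph (Fin n)) : ℝ :=
  sSup {x : ℝ | (pathMatrix G).charpoly.IsRoot x}

namespace SimpleGraph

variable {V : Type*} {G : SimpleGraph V} {u v : V}

/-- Deleting a non-bridge edge from a unicyclic graph leaves a tree. -/
theorem Connected.isTree_deleteEdges_of_not_isBridge [Finite V] (hG : G.Connected)
    (hcard : Nat.card G.edgeSet = Nat.card V) {e : Sym2 V} (he : e ∈ G.edgeSet)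
    (hb : ¬ G.IsBridge e) : (G.deleteEdges {e}).IsTree := by
  induction e with | h x y
  refine isTree_iff_connected_and_card.2 ⟨hG.connected_delete_edge_of_not_isBridge hb, ?_⟩
  rw [edgeSet_deleteEdges, ← hcard, Nat.card_coe_set_eq, Nat.card_coe_set_eq,
    Set.ncard_sdiff_singleton_add_one he (Set.toFinite _)]

theorem Walk.IsPath.mk_snd_notMem_edges {p q : G.Walk u v} (hp : p.IsPath) (hq : q.IsPath)
    (hpq : p ≠ q) (huv : u ≠ v) (hd : InternallyDisjoint p q) : s(u, p.snd) ∉ q.edges := by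
  cases p with
  | nil => exact absurd rfl huv
  | @cons _ x _ h p =>
    rw [Walk.snd_cons]
    intro hx
    obtain rfl | rfl := hd x (by simp) (q.snd_mem_support_of_mem_edges hx)
    · exact h.ne rfl
    · rw [Walk.cons_isPath_iff] at hp
      obtain rfl : p = .nil := by simpa using hp.1
      cases q with
      | nil => exact huv rfl
      | @cons _ y _ h' q =>
        rw [Walk.cons_isPath_iff] at hq
        rw [Walk.edges_cons, List.mem_cons] at hx
        obtain hx | hx := hx
        · obtain rfl : x = y := by simpa [h.ne'] using hx
          obtain rfl : q = .nil := by simpa using hq.1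
          exact hpq rfl
        · exact hq.2 (q.fst_mem_support_of_mem_edges hx)

theorem Walk.IsPath.not_isBridge_snd {p q : G.Walk u v} (hp : p.IsPath) (hq : q.IsPath)
    (hpq : p ≠ q) (huv : u ≠ v) (hd : InternallyDisjoint p q) : ¬ G.IsBridge s(u, p.snd) := by
  have hn := hp.mk_snd_notMem_edges hq hpq huv hd
  rw [isBridge_iff_forall_walk_mem_edges]
  push Not
  cases p with
  | nil => exact absurd rfl huv
  | @cons _ x _ h p =>
    rw [Walk.snd_cons] at hn ⊢
    refine ⟨q.append p.reverse, ?_⟩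
    rw [Walk.cons_isPath_iff] at hp
    simpa [hn] using fun hx => hp.2 (p.fst_mem_support_of_mem_edges hx)

theorem Walk.mk_snd_mem_edges {p : G.Walk u v} (huv : u ≠ v) : s(u, p.snd) ∈ p.edges := by
  cases p with
  | nil => exact absurd rfl huv
  | cons h p => simp

theorem _root_.InternallyDisjoint.symm {p q : G.Walk u v} (h : InternallyDisjoint p q) :
    InternallyDisjoint q p := fun w hw hw' => h w hw' hw

theorem Connected.not_three_disjoint_paths [Finite V] (hG : G.Connected)
    (hcard : Nat.card G.edgeSet = Nat.card V) (huv : u ≠ v) {p q r : G.Walk u v}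
    (hp : p.IsPath) (hq : q.IsPath) (hr : r.IsPath) (hpq : p ≠ q) (hpr : p ≠ r) (hqr : q ≠ r)
    (dpq : InternallyDisjoint p q) (dpr : InternallyDisjoint p r) : False := by
  have hT := hG.isTree_deleteEdges_of_not_isBridge hcard
    (p.edges_subset_edgeSet (Walk.mk_snd_mem_edges huv)) (hp.not_isBridge_snd hq hpq huv dpq)
  have hq' : ∀ e ∈ q.edges, e ∉ ({s(u, p.snd)} : Set (Sym2 V)) := by
    rintro _ he rfl
    exact hp.mk_snd_notMem_edges hq hpq huv dpq he
  have hr' : ∀ e ∈ r.edges, e ∉ ({s(u, p.snd)} : Set (Sym2 V)) := by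
    rintro _ he rfl
    exact hp.mk_snd_notMem_edges hr hpr huv dpr he
  have := (hT.isAcyclic.subsingleton_path u v).elim
    ⟨_, hq.toDeleteEdges G _ hq'⟩ ⟨_, hr.toDeleteEdges G _ hr'⟩
  apply hqr
  apply Walk.ext_support
  simpa using congrArg (fun p => p.1.support) this

theorem Walk.IsCycle.mem_support_of_disjoint_paths [Finite V] (hG : G.Connected)
    (hcard : Nat.card G.edgeSet = Nat.card V) {w : V} {c : G.Walk w w} (hc : c.IsCycle)
    (huv : u ≠ v) {p q : G.Walk u v} (hp : p.IsPath) (hq : q.IsPath) (hpq : p ≠ q)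
    (hd : InternallyDisjoint p q) : u ∈ c.support := by
  have hT := hG.isTree_deleteEdges_of_not_isBridge hcard
    (p.edges_subset_edgeSet (Walk.mk_snd_mem_edges huv)) (hp.not_isBridge_snd hq hpq huv hd)
  by_contra hu
  refine hT.isAcyclic (c.toDeleteEdges {s(u, p.snd)} ?_) (hc.toDeleteEdges G _ _)
  rintro _ he rfl
  exact hu (c.fst_mem_support_of_mem_edges he)

theorem _root_.InternallyDisjoint.reverse {p q : G.Walk u v} (h : InternallyDisjoint p q) :
    InternallyDisjoint p.reverse q.reverse := fun w hw hw' =>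
  (h w (by simpa using hw) (by simpa using hw')).symm

theorem Walk.IsCycle.exists_disjoint_paths {w : V} {c : G.Walk w w} (hc : c.IsCycle)
    (hu : u ∈ c.support) (hv : v ∈ c.support) (huv : u ≠ v) :
    ∃ p q : G.Walk u v, p.IsPath ∧ q.IsPath ∧ p ≠ q ∧ InternallyDisjoint p q := by
  classical
  have hc' := hc.rotate hu
  have hv' : v ∈ (c.rotate u hu).support := by simpa using hv
  set d := c.rotate u hu
  have hspec := d.take_spec hv'
  refine ⟨d.takeUntil v hv', (d.dropUntil v hv').reverse, hc'.isPath_takeUntil hv', ?_, ?_, ?_⟩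
  · rw [← hspec] at hc'
    exact (hc'.isPath_of_append_right (Walk.not_nil_of_ne huv)).reverse
  · intro h
    have he := (Walk.mk_snd_mem_edges (p := d.takeUntil v hv') huv)
    refine hc'.isTrail.disjoint_edges_takeUntil_dropUntil hv' he ?_
    have := congrArg Walk.edges h
    rw [Walk.edges_reverse] at this
    rw [this] at he
    simpa [← h] using he
  · intro x hx hy
    rw [Walk.support_reverse, List.mem_reverse] at hy
    have hn := hc'.support_nodup
    rw [← hspec, Walk.tail_support_append] at hn
    rw [Walk.mem_support_iff] at hx hy
    by_contra! hne
    exact List.disjoint_of_nodup_append hn (hx.resolve_left hne.1) (hy.resolve_left hne.2)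

theorem le_maxDisjointPaths_iff [Finite V] {k : ℕ} :
    k ≤ maxDisjointPaths G u v ↔ ∃ f : Fin k → G.Path u v, Function.Injective f ∧
      ∀ i j, i ≠ j → InternallyDisjoint (f i).1 (f j).1 := by
  classical
  have := Fintype.ofFinite V
  have hbdd : BddAbove {m : ℕ | ∃ f : Fin m → G.Path u v, Function.Injective f ∧
      ∀ i j, i ≠ j → InternallyDisjoint (f i).1 (f j).1} := by
    refine ⟨Nat.card (G.Path u v), ?_⟩
    rintro m ⟨f, hf, -⟩
    simpa using Nat.card_le_card_of_injective f hf
  refine ⟨fun hk => ?_, fun h => le_csSup hbdd h⟩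
  have hne : {m : ℕ | ∃ f : Fin m → G.Path u v, Function.Injective f ∧
      ∀ i j, i ≠ j → InternallyDisjoint (f i).1 (f j).1}.Nonempty :=
    ⟨0, Fin.elim0, fun i => i.elim0, fun i => i.elim0⟩
  obtain ⟨f, hf, hd⟩ := Nat.sSup_mem hne hbdd
  exact ⟨f ∘ Fin.castLE hk, hf.comp (Fin.castLE_injective hk), fun i j hij =>
    hd _ _ ((Fin.castLE_injective hk).ne hij)⟩

theorem two_le_maxDisjointPaths_iff [Finite V] : 2 ≤ maxDisjointPaths G u v ↔
    ∃ p q : G.Walk u v, p.IsPath ∧ q.IsPath ∧ p ≠ q ∧ InternallyDisjoint p q := by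
  rw [le_maxDisjointPaths_iff]
  constructor
  · rintro ⟨f, hf, hd⟩
    exact ⟨f 0, f 1, (f 0).2, (f 1).2, fun h => absurd (hf (Subtype.ext h)) (by decide),
      hd 0 1 (by decide)⟩
  · rintro ⟨p, q, hp, hq, hpq, hd⟩
    refine ⟨![⟨p, hp⟩, ⟨q, hq⟩], ?_, ?_⟩
    · intro i j
      fin_cases i <;> fin_cases j <;> simp [hpq, hpq.symm]
    · intro i j
      fin_cases i <;> fin_cases j <;> simp [hd, hd.symm]

theorem Connected.one_le_maxDisjointPaths [Finite V] (hG : G.Connected) :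
    1 ≤ maxDisjointPaths G u v := by
  obtain ⟨p, hp⟩ := hG.exists_isPath u v
  exact le_maxDisjointPaths_iff.2 ⟨fun _ => ⟨p, hp⟩, Function.injective_of_subsingleton _,
    fun i j h => absurd (Subsingleton.elim i j) h⟩

theorem Connected.maxDisjointPaths_le_two [Finite V] (hG : G.Connected)
    (hcard : Nat.card G.edgeSet = Nat.card V) (huv : u ≠ v) : maxDisjointPaths G u v ≤ 2 := by
  by_contra! h
  obtain ⟨f, hf, hd⟩ := le_maxDisjointPaths_iff.1 h
  have hne : ∀ i j, i ≠ j → (f i).1 ≠ (f j).1 := fun i j hij h => hij (hf (Subtype.ext h))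
  exact hG.not_three_disjoint_paths hcard huv (f 0).2 (f 1).2 (f 2).2
    (hne _ _ (by decide)) (hne _ _ (by decide)) (hne _ _ (by decide))
    (hd _ _ (by decide)) (hd _ _ (by decide))

theorem Walk.IsCycle.maxDisjointPaths_eq [Finite V] [DecidableEq V] (hG : G.Connected)
    (hcard : Nat.card G.edgeSet = Nat.card V) {w : V} {c : G.Walk w w} (hc : c.IsCycle)
    (huv : u ≠ v) :
    maxDisjointPaths G u v = if u ∈ c.support ∧ v ∈ c.support then 2 else 1 := by
  have h₁ := hG.one_le_maxDisjointPaths (u := u) (v := v)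
  have h₂ := hG.maxDisjointPaths_le_two hcard huv
  split_ifs with h
  · exact le_antisymm h₂ (two_le_maxDisjointPaths_iff.2 (hc.exists_disjoint_paths h.1 h.2 huv))
  · refine le_antisymm (Nat.le_of_lt_succ (lt_of_not_ge fun h₃ => h ?_)) h₁
    obtain ⟨p, q, hp, hq, hpq, hd⟩ := two_le_maxDisjointPaths_iff.1 h₃
    exact ⟨hc.mem_support_of_disjoint_paths hG hcard huv hp hq hpq hd,
      hc.mem_support_of_disjoint_paths hG hcard huv.symm hp.reverse hq.reverse
        (fun h => hpq (by simpa using congrArg Walk.reverse h)) hd.reverse⟩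

theorem Connected.exists_isCycle [Finite V] (hG : G.Connected)
    (hcard : Nat.card G.edgeSet = Nat.card V) : ∃ (w : V) (c : G.Walk w w), c.IsCycle := by
  by_contra! h
  have := (isTree_iff_connected_and_card.1 ⟨hG, h⟩).2
  lia

/-- A cycle through every vertex has as many edges as there are vertices. -/
theorem Walk.IsCycle.length_eq_card [Fintype V] {w : V} {c : G.Walk w w} (hc : c.IsCycle)
    (h : ∀ x, x ∈ c.support) : c.length = Fintype.card V := by
  classical
  have hm : ∀ x, x ∈ c.support.tail := fun x => by
    obtain rfl | hx := (Walk.mem_support_iff c).1 (h x)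
    · exact c.end_mem_tail_support hc.not_nil
    · exact hx
  have := List.toFinset_card_of_nodup hc.support_nodup
  rw [Finset.eq_univ_iff_forall.2 fun x => List.mem_toFinset.2 (hm x), Finset.card_univ] at this
  simpa using this.symm

end SimpleGraph

section Spectrum

variable {n : ℕ} {S : Finset (Fin n)} {A : Matrix (Fin n) (Fin n) ℝ}

theorem sum_mul_eq_of_clique_entries
    (hA : ∀ i j, A i j = if i = j then 0 else if i ∈ S ∧ j ∈ S then 2 else 1)
    (v : Fin n → ℝ) (i : Fin n) :
    ∑ j, A i j * v j =
      ∑ j, v j + (if i ∈ S then ∑ j ∈ S, v j else 0) - (1 + if i ∈ S then 1 else 0) * v i := by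
  have h : ∀ j, A i j * v j = v j + (if i ∈ S then if j ∈ S then v j else 0 else 0)
      - (if i = j then (1 + if i ∈ S then 1 else 0) * v j else 0) := by
    intro j
    rw [hA]
    by_cases hij : i = j
    · subst hij
      by_cases hi : i ∈ S <;> simp [hi]
      ring
    · by_cases hi : i ∈ S <;> by_cases hj : j ∈ S <;> simp [hi, hj, hij]
      ring
  simp_rw [h, Finset.sum_sub_distrib, Finset.sum_add_distrib]
  by_cases hi : i ∈ S <;> simp [hi]

theorem Matrix.IsHermitian.exists_unit_eigenvector (hH : A.IsHermitian) (k : Fin n) :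
    ∃ v : Fin n → ℝ, ∑ i, v i ^ 2 = 1 ∧ ∀ i, ∑ j, A i j * v j = hH.eigenvalues k * v i := by
  refine ⟨hH.eigenvectorBasis k, ?_, fun i => congrFun (hH.mulVec_eigenvectorBasis k) i⟩
  have := EuclideanSpace.real_norm_sq_eq (hH.eigenvectorBasis k)
  rw [hH.eigenvectorBasis.norm_eq_one] at this
  simpa using this.symm

/-- The Rayleigh quotient of a unit eigenvector. -/
theorem eigenvalue_eq_of_clique_entries
    (hA : ∀ i j, A i j = if i = j then 0 else if i ∈ S ∧ j ∈ S then 2 else 1)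
    {v : Fin n → ℝ} {μ : ℝ} (hv : ∑ i, v i ^ 2 = 1) (hμ : ∀ i, ∑ j, A i j * v j = μ * v i) :
    μ + 1 + ∑ i ∈ S, v i ^ 2 = (∑ i, v i) ^ 2 + (∑ i ∈ S, v i) ^ 2 := by
  have h : ∀ i, μ * v i ^ 2 + v i ^ 2 + (if i ∈ S then v i ^ 2 else 0) =
      v i * (∑ j, v j) + (if i ∈ S then v i else 0) * ∑ j ∈ S, v j := by
    intro i
    have := (hμ i).symm.trans (sum_mul_eq_of_clique_entries hA v i)
    split_ifs at this ⊢ <;> linear_combination v i * this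
  have := Finset.sum_congr rfl fun i (_ : i ∈ Finset.univ) => h i
  simp only [Finset.sum_add_distrib, ← Finset.mul_sum, ← Finset.sum_mul, hv, Finset.sum_ite_mem,
    Finset.univ_inter] at this
  linear_combination this

theorem neg_two_le_eigenvalues (hH : A.IsHermitian)
    (hA : ∀ i j, A i j = if i = j then 0 else if i ∈ S ∧ j ∈ S then 2 else 1) (k : Fin n) :
    -2 ≤ hH.eigenvalues k := by
  obtain ⟨v, hv, hμ⟩ := hH.exists_unit_eigenvector k
  have := eigenvalue_eq_of_clique_entries hA hv hμ
  have : ∑ i ∈ S, v i ^ 2 ≤ 1 := hv ▸ Finset.sum_le_univ_sum_of_nonneg fun i => sq_nonneg _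
  nlinarith [sq_nonneg (∑ i, v i), sq_nonneg (∑ i ∈ S, v i)]

theorem eigenvalues_le (hH : A.IsHermitian) (hS : S.Nonempty)
    (hA : ∀ i j, A i j = if i = j then 0 else if i ∈ S ∧ j ∈ S then 2 else 1) (k : Fin n) :
    hH.eigenvalues k ≤ n + S.card - 2 := by
  obtain ⟨v, hv, hμ⟩ := hH.exists_unit_eigenvector k
  have h := eigenvalue_eq_of_clique_entries hA hv hμ
  have h₁ : ∑ i ∈ S, v i ^ 2 ≤ 1 := hv ▸ Finset.sum_le_univ_sum_of_nonneg fun i => sq_nonneg _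
  have h₂ : (∑ i, v i) ^ 2 ≤ n * ∑ i, v i ^ 2 := by
    simpa using sq_sum_le_card_mul_sum_sq (s := Finset.univ) (f := v)
  have h₃ := sq_sum_le_card_mul_sum_sq (s := S) (f := v)
  have h₄ : (1 : ℝ) ≤ S.card := by exact_mod_cast hS.card_pos
  rw [hv] at h₂
  nlinarith

theorem eigenvalues_eq_or_eq (hH : A.IsHermitian)
    (hA : ∀ i j, A i j = if i = j then 0 else 2) (k : Fin n) :
    hH.eigenvalues k = -2 ∨ hH.eigenvalues k = 2 * n - 2 := by
  obtain ⟨v, hv, hμ⟩ := hH.exists_unit_eigenvector k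
  have hA' : ∀ i j, A i j = if i = j then 0 else
      if i ∈ (Finset.univ : Finset (Fin n)) ∧ j ∈ (Finset.univ : Finset (Fin n)) then 2 else 1 := by
    simpa using hA
  have h := eigenvalue_eq_of_clique_entries hA' hv hμ
  rw [hv] at h
  have h' : ∀ i, (hH.eigenvalues k + 2) * v i = 2 * ∑ j, v j := fun i => by
    have := (hμ i).symm.trans (sum_mul_eq_of_clique_entries hA' v i)
    simp only [Finset.mem_univ, if_true] at this
    linear_combination this
  have h'' : (hH.eigenvalues k + 2) * ∑ i, v i = n * (2 * ∑ j, v j) := by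
    rw [Finset.mul_sum, Finset.sum_congr rfl fun i _ => h' i]
    simp
  by_cases hs : ∑ i, v i = 0
  · rw [hs] at h
    left
    linarith
  · right
    apply mul_right_cancel₀ hs
    linear_combination h''

theorem sum_eigenvalues_eq_zero (hH : A.IsHermitian) (hA : ∀ i, A i i = 0) :
    ∑ k, hH.eigenvalues k = 0 := by
  have := hH.trace_eq_sum_eigenvalues
  simpa [Matrix.trace, hA] using this.symm

theorem sum_abs_eigenvalues_lt (hH : A.IsHermitian) (hn : 2 ≤ n) (hS : S.Nonempty)
    (hS' : S ≠ Finset.univ)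
    (hA : ∀ i j, A i j = if i = j then 0 else if i ∈ S ∧ j ∈ S then 2 else 1) :
    ∑ k, |hH.eigenvalues k| < 4 * ((n : ℝ) - 1) := by
  have hn' : (2 : ℝ) ≤ n := by exact_mod_cast hn
  have hcard : (S.card : ℝ) + 1 ≤ n := by
    have := Finset.card_lt_card (Finset.ssubset_univ_iff.2 hS')
    rw [Finset.card_univ, Fintype.card_fin] at this
    exact_mod_cast this
  have hsum := sum_eigenvalues_eq_zero hH fun i => by simp [hA]
  have key : ∑ k, n * |hH.eigenvalues k| <
      ∑ k, ((n - 2) * hH.eigenvalues k + 4 * ((n : ℝ) - 1)) := by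
    have hlo := neg_two_le_eigenvalues hH hA
    have hup := eigenvalues_le hH hS hA
    apply Finset.sum_lt_sum
    · intro k _
      cases abs_cases (hH.eigenvalues k) <;> nlinarith [hlo k, hup k]
    · obtain ⟨k, hk⟩ : ∃ k, 0 ≤ hH.eigenvalues k := by
        by_contra! h
        have := Finset.sum_lt_sum_of_nonempty (s := Finset.univ) ⟨⟨0, by lia⟩, Finset.mem_univ _⟩
          fun k _ => h k
        simp [hsum] at this
      refine ⟨k, Finset.mem_univ _, ?_⟩
      rw [abs_of_nonneg hk]
      nlinarith [hup k]
  rw [← Finset.mul_sum, Finset.sum_add_distrib, ← Finset.mul_sum, hsum] at key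
  simp only [Finset.sum_const, Finset.card_univ, Fintype.card_fin, nsmul_eq_mul, mul_zero,
    zero_add] at key
  exact lt_of_mul_lt_mul_left key (by linarith)

theorem sum_abs_eigenvalues_eq (hH : A.IsHermitian) (hn : 2 ≤ n)
    (hA : ∀ i j, A i j = if i = j then 0 else 2) :
    ∑ k, |hH.eigenvalues k| = 4 * ((n : ℝ) - 1) := by
  have hn' : (2 : ℝ) ≤ n := by exact_mod_cast hn
  have hsum := sum_eigenvalues_eq_zero hH fun i => by simp [hA]
  have key : ∑ k, n * |hH.eigenvalues k| =
      ∑ k, ((n - 2) * hH.eigenvalues k + 4 * ((n : ℝ) - 1)) := by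
    refine Finset.sum_congr rfl fun k _ => ?_
    obtain h | h := eigenvalues_eq_or_eq hH hA k
    · rw [h, abs_of_neg (by norm_num)]
      ring
    · rw [h, abs_of_nonneg (by linarith)]
      ring
  rw [← Finset.mul_sum, Finset.sum_add_distrib, ← Finset.mul_sum, hsum] at key
  simp only [Finset.sum_const, Finset.card_univ, Fintype.card_fin, nsmul_eq_mul, mul_zero,
    zero_add] at key
  exact mul_left_cancel₀ (by linarith) key

theorem pathEnergy_eq_sum_abs_eigenvalues (G : SimpleGraph (Fin n))
    (hH : (pathMatrix G).IsHermitian) : pathEnergy G = ∑ k, |hH.eigenvalues k| := by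
  rw [pathEnergy, hH.roots_charpoly_eq_eigenvalues, Multiset.map_map]
  rfl

end Spectrum

/-- A copy of a graph in a finite graph with no more vertices and no more edges is an isomorphism. -/
theorem SimpleGraph.Copy.nonempty_iso {V W : Type*} [Finite W] {G : SimpleGraph V}
    {H : SimpleGraph W} (f : Copy G H) (hV : Nat.card W ≤ Nat.card V)
    (hE : Nat.card H.edgeSet ≤ Nat.card G.edgeSet) : Nonempty (G ≃g H) := by
  have hf : Function.Bijective f := f.injective.bijective_of_nat_card_le hV
  have hfe : Function.Bijective f.toHom.mapEdgeSet :=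
    (Hom.mapEdgeSet.injective f.toHom f.injective).bijective_of_nat_card_le hE
  refine ⟨⟨Equiv.ofBijective f hf, fun {a b} => ⟨fun h => ?_, fun h => f.toHom.map_adj h⟩⟩⟩
  obtain ⟨⟨e, he⟩, h'⟩ := hfe.2 ⟨s(f a, f b), h⟩
  have h'' : Sym2.map f e = Sym2.map f s(a, b) := congrArg Subtype.val h'
  rw [Sym2.map.injective f.injective h''] at he
  exact he

theorem SimpleGraph.card_edgeSet_cycleGraph {n : ℕ} (hn : 3 ≤ n) :
    Nat.card (cycleGraph n).edgeSet = n := by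
  obtain ⟨m, rfl⟩ := Nat.exists_eq_add_of_le' hn
  have := (cycleGraph (m + 3)).sum_degrees_eq_twice_card_edges
  simp only [cycleGraph_degree_three_le, Finset.sum_const, Finset.card_univ, Fintype.card_fin,
    smul_eq_mul] at this
  rw [Nat.card_eq_fintype_card, ← edgeFinset_card]
  lia

theorem SimpleGraph.Connected.nonempty_iso_cycleGraph_iff {n : ℕ} (hn : 3 ≤ n)
    {G : SimpleGraph (Fin n)} (hG : G.Connected) (hedges : Nat.card G.edgeSet = n) {w : Fin n}
    {c : G.Walk w w} (hc : c.IsCycle) :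
    Nonempty (G ≃g cycleGraph n) ↔ ∀ x, x ∈ c.support := by
  constructor
  · rintro ⟨e⟩ x
    obtain ⟨v, d, hd, hlen⟩ := (cycleGraph_isContained_iff hn).1 ⟨e.symm.toCopy⟩
    have hall := (Walk.isHamiltonianCycle_iff_isCycle_and_length_eq.2
      ⟨hd, by simpa using hlen⟩).mem_support
    have : Nontrivial (Fin n) := Fin.nontrivial_iff_two_le.2 (by lia)
    obtain ⟨y, hy⟩ := exists_ne x
    obtain ⟨p, q, hp, hq, hpq, hdisj⟩ := hd.exists_disjoint_paths (hall x) (hall y) hy.symm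
    exact hc.mem_support_of_disjoint_paths hG (by simpa using hedges) hy.symm hp hq hpq hdisj
  · intro h
    obtain ⟨f⟩ := (cycleGraph_isContained_iff (by lia)).2
      ⟨w, c, hc, (hc.length_eq_card h).trans (Fintype.card_fin n)⟩
    obtain ⟨e⟩ := f.nonempty_iso le_rfl (by rw [hedges, card_edgeSet_cycleGraph hn])
    exact ⟨e.symm⟩

/-- for a unicyclic graph on n ≥ 3 vertices, PE(G) ≤ 4(n − 1),
with equality iff G is the cycle C_n. -/
theorem pathEnergy_unicyclic_max {n : ℕ} (hn : 3 ≤ n)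
    (G : SimpleGraph (Fin n)) (hG : G.Connected)
    (hedges : Nat.card G.edgeSet = n) :
    pathEnergy G ≤ 4 * ((n : ℝ) - 1) ∧
      (pathEnergy G = 4 * ((n : ℝ) - 1) ↔ Nonempty (G ≃g cycleGraph n)) := by
  have hcard : Nat.card G.edgeSet = Nat.card (Fin n) := by simpa using hedges
  obtain ⟨w, c, hc⟩ := hG.exists_isCycle hcard
  have hA : ∀ i j, pathMatrix G i j = if i = j then 0 else
      if i ∈ c.support.toFinset ∧ j ∈ c.support.toFinset then 2 else 1 := by
    intro i j
    rw [pathMatrix, Matrix.of_apply]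
    split_ifs <;> simp_all [hc.maxDisjointPaths_eq hG hcard]
  have hH : (pathMatrix G).IsHermitian := by
    refine Matrix.IsHermitian.ext fun i j => ?_
    simp only [hA, star_trivial, eq_comm (a := j), and_comm (a := j ∈ _)]
  rw [pathEnergy_eq_sum_abs_eigenvalues G hH, hG.nonempty_iso_cycleGraph_iff hn hedges hc]
  by_cases h : ∀ x, x ∈ c.support
  · have heq := sum_abs_eigenvalues_eq hH (by lia) (by simpa [h] using hA)
    exact ⟨heq.le, iff_of_true heq h⟩
  · have hlt := sum_abs_eigenvalues_lt hH (by lia) ⟨w, by simp⟩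
      (fun hS => h fun x => by simpa using Finset.eq_univ_iff_forall.1 hS x) hA
    exact ⟨hlt.le, iff_of_false hlt.ne h⟩
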